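/- arXiv:2501.17108 — 2 statements merged into one kernel-verified Lean document; each statement's English description precedes it below -/
import Mathlib

section
/- Faà di Bruno's formula: Let n, m, p be positive integers and let f: ℝ^m → ℝ^p and u: ℝ → ℝ^m be n times continuously differentiable. Then for every t ∈ ℝ, d^n/dt^n [f(u(t))] = Σ_{s ∈ P_n} (n choose s) · f^{(|s|)}(u(t)) (D^s u(t)). -/
open Finset

/-- Given block sizes `s 0, …, s (n-1)`, `blockIndex s ν` is the index `j` of the block
to which the `ν`-th column belongs, i.e. the unique `j` with
`∑_{l < j} s l ≤ ν < ∑_{l ≤ j} s l` (when `ν < ∑ s`). -/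
def blockIndex {n : ℕ} (s : Fin n → ℕ) (ν : ℕ) : ℕ :=
  (Finset.univ.filter fun j : Fin n =>
    (∑ l ∈ Finset.univ.filter (fun l => l < j), s l) + s j ≤ ν).card

noncomputable def DLf {E F : Type*} [NormedAddCommGroup E] [NormedSpace ℝ E]
    [NormedAddCommGroup F] [NormedSpace ℝ F] (f : E → F) : List E → E → F
  | [] => f
  | v :: L => fun x => fderiv ℝ (DLf f L) x v

section
variable {E F : Type*} [NormedAddCommGroup E] [NormedSpace ℝ E]
    [NormedAddCommGroup F] [NormedSpace ℝ F]

theorem DLf_contDiff {f : E → F} {n : ℕ} (hf : ContDiff ℝ n f) (L : List E) :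
    ∀ k : ℕ, L.length + k ≤ n → ContDiff ℝ k (DLf f L) := by
  induction L with
  | nil => intro k hk; exact hf.of_le (by simpa using hk)
  | cons v L ih =>
    intro k hk
    have h1 := ih (k + 1) (by simp at hk; omega)
    have h2 : ContDiff ℝ k (fderiv ℝ (DLf f L)) := h1.fderiv_right (by norm_cast)
    exact h2.clm_apply contDiff_const

theorem DLf_perm {f : E → F} {n : ℕ} (hf : ContDiff ℝ n f) {L L' : List E} (h : L.Perm L') :
    L.length ≤ n → DLf f L = DLf f L' := by
  induction h with
  | nil => intro _; rfl
  | cons v h ih =>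
    intro hl
    simp only [DLf]
    rw [ih (by simp at hl; omega)]
  | swap v w L =>
    intro hl
    have h2 := DLf_contDiff hf L 2 (by simp at hl; omega)
    funext x
    have hs : IsSymmSndFDerivAt ℝ (DLf f L) x :=
      h2.contDiffAt.isSymmSndFDerivAt (by simp)
    have hd : DifferentiableAt ℝ (fderiv ℝ (DLf f L)) x :=
      ((h2.fderiv_right (m := 1) (by norm_num)).differentiable (by simp)) x
    simp only [DLf]
    rw [fderiv_clm_apply hd (differentiableAt_const _), fderiv_clm_apply hd (differentiableAt_const _)]
    simpa using hs.eq _ _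
  | trans h1 h2 ih1 ih2 =>
    intro hl
    rw [ih1 hl, ih2 (by rw [← h1.length_eq]; exact hl)]

theorem iteratedFDeriv_eq_DLf {f : E → F} : ∀ (k : ℕ) (_ : ContDiff ℝ k f) (x : E) (v : Fin k → E),
    iteratedFDeriv ℝ k f x v = DLf f (List.ofFn v) x := by
  intro k
  induction k with
  | zero => intro _ x v; simp [DLf]
  | succ k ih =>
    intro hf x v
    have hf' : ContDiff ℝ k f := hf.of_le (by norm_cast; omega)
    rw [iteratedFDeriv_succ_apply_left, List.ofFn_succ]
    simp only [DLf]
    have : DLf f (List.ofFn fun i : Fin k => v i.succ) =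
        fun y => iteratedFDeriv ℝ k f y (Fin.tail v) := by
      funext y; rw [ih hf']; rfl
    rw [this]
    have hd : DifferentiableAt ℝ (iteratedFDeriv ℝ k f) x :=
      hf.differentiable_iteratedFDeriv (by norm_cast; omega) x
    have h3 : HasFDerivAt (fun y => iteratedFDeriv ℝ k f y (Fin.tail v))
       ((ContinuousMultilinearMap.apply ℝ (fun _ : Fin k => E) F (Fin.tail v)).comp (fderiv ℝ (iteratedFDeriv ℝ k f) x)) x :=
      (ContinuousMultilinearMap.apply ℝ (fun _ : Fin k => E) F (Fin.tail v)).hasFDerivAt.comp x hd.hasFDerivAt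
    rw [h3.fderiv]
    rfl
end

theorem blockIndex_fin {n : ℕ} (s : Fin n → ℕ) (k : (i : Fin n) × Fin (s i)) :
    blockIndex s (finSigmaFinEquiv k : Fin (∑ j, s j)).1 = k.1 := by
  obtain ⟨i, a⟩ := k
  have hS : ∑ l : Fin i.1, s (Fin.castLE i.2.le l) = ∑ l ∈ univ.filter (fun l => l < i), s l := by
    symm
    apply Finset.sum_bij' (i := fun l hl => ⟨l.1, by simpa using hl⟩)
      (j := fun l _ => Fin.castLE i.2.le l) <;> simp
    intro a; exact a.2
  rw [finSigmaFinEquiv_apply, blockIndex]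
  simp only [hS]
  have : (univ.filter fun j : Fin n => (∑ l ∈ univ.filter (fun l => l < j), s l) + s j ≤
      ∑ l ∈ univ.filter (fun l => l < i), s l + a.1) = Finset.Iio i := by
    ext j
    simp only [mem_filter, mem_univ, true_and, mem_Iio]
    have key : ∀ j i : Fin n, j < i → (∑ l ∈ univ.filter (fun l => l < j), s l) + s j ≤
        ∑ l ∈ univ.filter (fun l => l < i), s l := by
      intro j i hji
      rw [add_comm, ← Finset.sum_insert (by simp)]
      apply Finset.sum_le_sum_of_subset
      intro l hl
      simp only [mem_insert, mem_filter, mem_univ, true_and] at hl ⊢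
      rcases hl with rfl | hl
      · exact hji
      · exact hl.trans hji
    constructor
    · intro h
      by_contra hc
      rcases (not_lt.mp hc).eq_or_lt with rfl | h'
      · have := a.2; simp at this; omega
      · have := key i j h'; have := a.2; simp at this; omega
    · intro h; have := key j i h; omega
  rw [this]; simp

def partsMS {n : ℕ} (c : OrderedFinpartition n) : Multiset ℕ := univ.val.map c.partSize

noncomputable def cf (M : Multiset ℕ) : ℝ :=
  ((M.map (fun j => (j.factorial : ℝ))).prod * ∏ j ∈ M.toFinset, ((M.count j).factorial : ℝ))⁻¹

def PP (n : ℕ) : Finset (Multiset ℕ) := (univ : Finset (Nat.Partition n)).image Nat.Partition.parts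

theorem mem_PP {n : ℕ} {M : Multiset ℕ} : M ∈ PP n ↔ 0 ∉ M ∧ M.sum = n := by
  simp only [PP, mem_image, mem_univ, true_and]
  constructor
  · rintro ⟨p, rfl⟩
    exact ⟨fun h => absurd (p.parts_pos h) (by simp), p.parts_sum⟩
  · rintro ⟨h1, h2⟩
    exact ⟨⟨M, fun {i} hi => Nat.pos_of_ne_zero (by rintro rfl; exact h1 hi), h2⟩, rfl⟩

theorem cf_cons (j : ℕ) (M : Multiset ℕ) :
    cf (j ::ₘ M) * (M.count j + 1) * j.factorial = cf M := by
  have hp : ∀ A : Finset ℕ, M.toFinset ⊆ A →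
      ∏ j ∈ M.toFinset, ((M.count j).factorial : ℝ) = ∏ j ∈ A, ((M.count j).factorial : ℝ) := by
    intro A hA
    apply Finset.prod_subset hA
    intro x _ hx
    rw [Multiset.count_eq_zero_of_notMem (by simpa using hx)]; simp
  unfold cf
  rw [hp (insert j M.toFinset) (by simp), Multiset.toFinset_cons, Multiset.map_cons, Multiset.prod_cons,
    ← Finset.mul_prod_erase _ _ (mem_insert_self j M.toFinset),
    ← Finset.mul_prod_erase _ _ (mem_insert_self j M.toFinset), Multiset.count_cons_self]
  have : ∏ x ∈ (insert j M.toFinset).erase j, (((j ::ₘ M).count x).factorial : ℝ) =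
      ∏ x ∈ (insert j M.toFinset).erase j, ((M.count x).factorial : ℝ) := by
    apply Finset.prod_congr rfl
    intro x hx
    rw [Multiset.count_cons_of_ne (by simp at hx; exact hx.1)]
  rw [this, Nat.factorial_succ]
  have h1 : ((M.map (fun j => (j.factorial : ℝ))).prod) ≠ 0 := by
    apply Multiset.prod_ne_zero; simp [Nat.factorial_ne_zero]
  have h2 : ∏ x ∈ (insert j M.toFinset).erase j, ((M.count x).factorial : ℝ) ≠ 0 := by
    apply Finset.prod_ne_zero_iff.mpr; intros; positivity
  have h3 : (j.factorial : ℝ) ≠ 0 := by positivity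
  have h4 : ((M.count j).factorial : ℝ) ≠ 0 := by positivity
  push_cast
  field_simp

theorem sum_PP_succ {V : Type*} [AddCommGroup V] [Module ℝ V] (G : Multiset ℕ → V) (n : ℕ) :
    ∑ M ∈ PP (n + 1), ((n + 1).factorial * cf M) • G M =
    ∑ M ∈ PP n, (n.factorial * cf M) •
      (G (1 ::ₘ M) + ∑ j ∈ M.toFinset, (M.count j : ℝ) • G ((j + 1) ::ₘ M.erase j)) := by
  have e1 : ∀ M ∈ PP (n + 1), ((n + 1).factorial * cf M) • G M =
      ∑ j ∈ M.toFinset, ((n.factorial : ℝ) * (j * M.count j) * cf M) • G M := by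
    intro M hM
    rw [mem_PP] at hM
    rw [← Finset.sum_smul, ← Finset.sum_mul, ← Finset.mul_sum]
    have : ((n + 1 : ℕ) : ℝ) = ∑ j ∈ M.toFinset, ((j : ℝ) * M.count j) := by
      rw [← hM.2, Finset.sum_multiset_count]
      push_cast
      apply Finset.sum_congr rfl; intros; simp [mul_comm]
    rw [← this, Nat.factorial_succ]; push_cast; congr 1; ring
  have e2 : ∀ M ∈ PP n, (n.factorial * cf M) •
      (G (1 ::ₘ M) + ∑ j ∈ M.toFinset, (M.count j : ℝ) • G ((j + 1) ::ₘ M.erase j)) =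
      ∑ j ∈ insert 0 M.toFinset, ((n.factorial : ℝ) * cf M * (if j = 0 then 1 else M.count j)) •
         G ((j + 1) ::ₘ M.erase j) := by
    intro M hM
    rw [mem_PP] at hM
    rw [Finset.sum_insert (by simpa using hM.1), smul_add, Finset.smul_sum]
    congr 1
    · simp [Multiset.erase_of_notMem hM.1]
    · apply Finset.sum_congr rfl
      intro j hj
      have : j ≠ 0 := by rintro rfl; simp at hj; exact hM.1 hj
      rw [smul_smul, if_neg this]
  rw [Finset.sum_congr rfl e1, Finset.sum_congr rfl e2, Finset.sum_sigma', Finset.sum_sigma']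
  -- the bijection
  let back : Multiset ℕ → ℕ → Multiset ℕ := fun M j =>
    if j = 1 then M.erase 1 else (j - 1) ::ₘ M.erase j
  apply Finset.sum_bij' (i := fun x _ => (⟨back x.1 x.2, x.2 - 1⟩ : (_ : Multiset ℕ) × ℕ))
    (j := fun x _ => (⟨(x.2 + 1) ::ₘ x.1.erase x.2, x.2 + 1⟩ : (_ : Multiset ℕ) × ℕ))
  · rintro ⟨M, j⟩ h
    simp only [mem_sigma, mem_PP, Multiset.mem_toFinset, mem_insert] at h ⊢
    obtain ⟨⟨h0, hs⟩, hj⟩ := h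
    obtain ⟨R, rfl⟩ := Multiset.exists_cons_of_mem hj
    simp only [back]
    simp at h0 hs
    split_ifs with h1
    · subst h1; simp; exact ⟨h0.2, by omega⟩
    · simp; exact ⟨⟨by omega, h0.2⟩, by omega⟩
  · rintro ⟨M, j⟩ h
    simp only [mem_sigma, mem_PP, Multiset.mem_toFinset, mem_insert] at h ⊢
    obtain ⟨⟨h0, hs⟩, hj⟩ := h
    rcases hj with rfl | hj
    · rw [Multiset.erase_of_notMem h0]; simp; exact ⟨h0, by omega⟩
    · obtain ⟨R, rfl⟩ := Multiset.exists_cons_of_mem hj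
      simp at h0 hs ⊢
      exact ⟨h0.2, by omega⟩
  · rintro ⟨M, j⟩ h
    simp only [mem_sigma, mem_PP, Multiset.mem_toFinset] at h
    obtain ⟨⟨h0, hs⟩, hj⟩ := h
    obtain ⟨R, rfl⟩ := Multiset.exists_cons_of_mem hj
    simp at h0
    simp only [back]
    split_ifs with h1
    · subst h1; simp [Multiset.erase_of_notMem h0.2]
    · have : j - 1 + 1 = j := by omega
      simp [this]
  · rintro ⟨M, j⟩ h
    simp only [mem_sigma, mem_PP, Multiset.mem_toFinset, mem_insert] at h
    obtain ⟨⟨h0, hs⟩, hj⟩ := h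
    simp only [back]
    rcases hj with rfl | hj
    · simp [Multiset.erase_of_notMem h0]
    · obtain ⟨R, rfl⟩ := Multiset.exists_cons_of_mem hj
      simp at h0
      have : j ≠ 0 := by omega
      simp [this]
  · rintro ⟨M, j⟩ h
    simp only [mem_sigma, mem_PP, Multiset.mem_toFinset] at h
    obtain ⟨⟨h0, hs⟩, hj⟩ := h
    obtain ⟨R, rfl⟩ := Multiset.exists_cons_of_mem hj
    simp at h0
    simp only [back]
    split_ifs with h1 h2 h2
    · subst h1
      simp [Multiset.erase_of_notMem h0.2]
      congr 1
      have := cf_cons 1 R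
      simp at this
      rw [← this]; ring
    · omega
    · omega
    · obtain ⟨k, rfl⟩ : ∃ k, j = k + 1 := ⟨j - 1, by omega⟩
      simp
      congr 1
      have a1 := cf_cons (k + 1) R
      have a2 := cf_cons k R
      rw [Nat.factorial_succ] at a1
      have h3 : (k.factorial : ℝ) ≠ 0 := by positivity
      have : cf ((k + 1) ::ₘ R) * (R.count (k + 1) + 1) * (k + 1) =
        cf (k ::ₘ R) * (R.count k + 1) := by
        apply mul_right_cancel₀ h3
        push_cast at a1
        rw [a2, ← a1]; ring
      linear_combination (n.factorial : ℝ) * this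

theorem map_update_ms {k : ℕ} (w : Fin k → ℕ) (i : Fin k) (b : ℕ) :
    (univ.val.map (Function.update w i b)) = b ::ₘ (univ.val.map w).erase (w i) := by
  have : (univ : Finset (Fin k)).val = i ::ₘ ((univ : Finset (Fin k)).erase i).val := by
    rw [← Finset.insert_val_of_notMem (by simp), Finset.insert_erase (mem_univ i)]
  rw [this]
  simp only [Multiset.map_cons, Function.update_self, Multiset.erase_cons_head]
  congr 1
  apply Multiset.map_congr rfl
  intro x hx
  have : x ≠ i := by
    rw [Finset.mem_val] at hx; simp at hx; exact hx
  simp [this]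

theorem sum_OFP {V : Type*} [AddCommGroup V] [Module ℝ V] (n : ℕ) : ∀ (G : Multiset ℕ → V),
    ∑ c : OrderedFinpartition n, G (partsMS c) = ∑ M ∈ PP n, (n.factorial * cf M) • G M := by
  induction n with
  | zero =>
    intro G
    have : PP 0 = {0} := by
      ext M
      rw [mem_PP, mem_singleton]
      constructor
      · rintro ⟨h1, h2⟩
        rw [Multiset.eq_zero_iff_forall_notMem]
        intro a ha
        have := Multiset.sum_eq_zero_iff.mp h2 a ha
        subst this; exact h1 ha
      · rintro rfl; simp
    rw [this]
    have h0 : ∀ c : OrderedFinpartition 0, partsMS c = 0 := by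
      intro c
      have := c.length_le
      rw [← Multiset.card_eq_zero]; simp [partsMS]; omega
    simp [cf, h0]
  | succ n ih =>
    intro G
    rw [sum_PP_succ, ← ih (fun M => G (1 ::ₘ M) + ∑ j ∈ M.toFinset, (M.count j : ℝ) • G ((j + 1) ::ₘ M.erase j)),
      ← (OrderedFinpartition.extendEquiv n).sum_comp, Fintype.sum_sigma]
    apply Finset.sum_congr rfl
    intro c _
    rw [Fintype.sum_option]
    simp only [OrderedFinpartition.extendEquiv_apply]
    congr 1
    · congr 1
      change Multiset.map (Fin.cons 1 c.partSize : Fin (c.length + 1) → ℕ) univ.val =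
        1 ::ₘ Multiset.map c.partSize univ.val
      rw [Fin.univ_val_map, Fin.univ_val_map, List.ofFn_succ]
      simp
    · have : ∀ i : Fin c.length, G (partsMS (c.extend (some i))) =
          G ((c.partSize i + 1) ::ₘ (partsMS c).erase (c.partSize i)) := by
        intro i
        congr 1
        exact map_update_ms c.partSize i _
      simp only [this]
      have h := Finset.sum_multiset_map_count (partsMS c) (fun j => G ((j + 1) ::ₘ (partsMS c).erase j))
      simp only [Nat.cast_smul_eq_nsmul]
      rw [← h]
      conv_rhs => rw [show partsMS c = univ.val.map c.partSize from rfl]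
      rw [Multiset.map_map]
      rfl

def msOf {n : ℕ} (s : Fin n → ℕ) : Multiset ℕ := ∑ j : Fin n, Multiset.replicate (s j) (j.1 + 1)

theorem count_msOf {n : ℕ} (s : Fin n → ℕ) (a : ℕ) :
    (msOf s).count a = ∑ j : Fin n, if j.1 + 1 = a then s j else 0 := by
  simp [msOf, Multiset.count_sum', Multiset.count_replicate]

theorem count_msOf_succ {n : ℕ} (s : Fin n → ℕ) (j : Fin n) :
    (msOf s).count (j.1 + 1) = s j := by
  rw [count_msOf, Finset.sum_eq_single j]
  · simp
  · intro b _ hb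
    rw [if_neg]
    intro h; apply hb; ext; omega
  · simp

theorem mem_msOf {n : ℕ} (s : Fin n → ℕ) (a : ℕ) (h : a ∈ msOf s) : ∃ j : Fin n, j.1 + 1 = a := by
  by_contra hc
  push Not at hc
  rw [← Multiset.count_pos, count_msOf] at h
  simp [hc] at h

theorem sum_msOf {n : ℕ} (s : Fin n → ℕ) : (msOf s).sum = ∑ j : Fin n, (j.1 + 1) * s j := by
  rw [msOf, ← Multiset.coe_sumAddMonoidHom, map_sum]
  simp [mul_comm]

theorem bij_msOf (n : ℕ) : Set.BijOn (msOf (n := n))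
    {s : Fin n → ℕ | ∑ j : Fin n, (j.val + 1) * s j = n} (PP n : Set (Multiset ℕ)) := by
  refine ⟨?_, ?_, ?_⟩
  · intro s hs
    rw [Finset.mem_coe, mem_PP, sum_msOf]
    refine ⟨fun h => ?_, hs⟩
    obtain ⟨j, hj⟩ := mem_msOf s 0 h
    omega
  · intro s _ s' _ h
    funext j
    rw [← count_msOf_succ s j, ← count_msOf_succ s' j, h]
  · intro M hM
    rw [Finset.mem_coe, mem_PP] at hM
    have : msOf (fun j : Fin n => M.count (j.1 + 1)) = M := by
      ext a
      by_cases ha : a ∈ M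
      · have h1 : a ≤ n := by rw [← hM.2]; exact Multiset.le_sum_of_mem ha
        have h2 : a ≠ 0 := by rintro rfl; exact hM.1 ha
        have := count_msOf_succ (fun j : Fin n => M.count (j.1 + 1)) ⟨a - 1, by omega⟩
        simpa [Nat.sub_add_cancel (Nat.pos_of_ne_zero h2)] using this
      · rw [Multiset.count_eq_zero_of_notMem ha, count_msOf]
        apply Finset.sum_eq_zero
        intro j _
        split_ifs with h
        · rw [h]; exact Multiset.count_eq_zero_of_notMem ha
        · rfl
    refine ⟨_, ?_, this⟩
    rw [Set.mem_setOf_eq, ← sum_msOf, this]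
    exact hM.2

theorem map_blockIndex {n : ℕ} (s : Fin n → ℕ) :
    (univ : Finset (Fin (∑ j, s j))).val.map (fun ν => blockIndex s ν.1 + 1) = msOf s := by
  ext a
  rw [count_msOf, Multiset.count_map, ← Finset.filter_val, Finset.card_val, Finset.card_filter,
    ← finSigmaFinEquiv.sum_comp, Fintype.sum_sigma]
  apply Finset.sum_congr rfl
  intro j _
  simp only [blockIndex_fin]
  simp [eq_comm]

theorem cf_msOf {n : ℕ} (s : Fin n → ℕ) :
    cf (msOf s) = (∏ j, ((s j).factorial : ℝ))⁻¹ *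
      ∏ ν : Fin (∑ j, s j), (((blockIndex s ν.1 + 1).factorial : ℝ))⁻¹ := by
  have h1 : ∏ a ∈ (msOf s).toFinset, (((msOf s).count a).factorial : ℝ) =
      ∏ j, ((s j).factorial : ℝ) := by
    have : (msOf s).toFinset ⊆ univ.image (fun j : Fin n => j.1 + 1) := by
      intro a ha
      obtain ⟨j, hj⟩ := mem_msOf s a (by simpa using ha)
      simp only [mem_image, mem_univ, true_and]
      exact ⟨j, hj⟩
    rw [Finset.prod_subset this, Finset.prod_image]
    · simp [count_msOf_succ]
    · intro x _ y _ h
      ext; simpa using h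
    · intro x _ hx
      rw [Multiset.count_eq_zero_of_notMem (by simpa using hx)]; simp
  have h2 : ((msOf s).map (fun j => (j.factorial : ℝ))).prod =
      ∏ ν : Fin (∑ j, s j), ((blockIndex s ν.1 + 1).factorial : ℝ) := by
    rw [← map_blockIndex, Multiset.map_map]; rfl
  rw [cf, h1, h2, mul_inv, mul_comm, Finset.prod_inv_distrib]

/-- **Faà di Bruno's formula.**  For `f : ℝ^m → ℝ^p` and `u : ℝ → ℝ^m` both `n` times
continuously differentiable,
`d^n/dt^n (f ∘ u)(t) = ∑_{s ∈ P_n} (n!/(s_1!⋯s_n!)) f^{(|s|)}(u(t)) (D^s u(t))`,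
where `P_n = {s : ∑ j·s_j = n}`, `|s| = ∑ s_j`, and `D^s u(t)` is the `m × |s|` matrix
having, for each `j = 1,…,n`, exactly `s_j` columns equal to `u^{(j)}(t)/j!`; the action of
the `|s|`-th derivative tensor of `f` on the columns is the iterated Fréchet derivative. -/
theorem faa_di_bruno (n m p : ℕ) (hn : 0 < n) (hm : 0 < m) (hp : 0 < p)
    (f : (Fin m → ℝ) → Fin p → ℝ) (u : ℝ → Fin m → ℝ)
    (hf : ContDiff ℝ n f) (hu : ContDiff ℝ n u) (t : ℝ) :
    iteratedDeriv n (fun x => f (u x)) t =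
      ∑ᶠ s ∈ {s : Fin n → ℕ | ∑ j : Fin n, (j.val + 1) * s j = n},
        ((n.factorial : ℝ) / ∏ j, ((s j).factorial : ℝ)) •
          iteratedFDeriv ℝ (∑ j, s j) f (u t)
            (fun ν : Fin (∑ j, s j) =>
              (((blockIndex s ν.1 + 1).factorial : ℝ))⁻¹ •
                iteratedDeriv (blockIndex s ν.1 + 1) u t) := by
  let G : Multiset ℕ → Fin p → ℝ := fun M =>
    DLf f (M.toList.map (fun j => iteratedDeriv j u t)) (u t)
  have hG : ∀ (k : ℕ) (w : Fin k → ℕ), k ≤ n →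
      iteratedFDeriv ℝ k f (u t) (fun i => iteratedDeriv (w i) u t) = G (univ.val.map w) := by
    intro k w hk
    rw [iteratedFDeriv_eq_DLf k (hf.of_le (by exact_mod_cast hk))]
    have hperm : (List.ofFn fun i => iteratedDeriv (w i) u t).Perm
        ((univ.val.map w).toList.map (fun j => iteratedDeriv j u t)) := by
      have : (List.ofFn w).Perm (univ.val.map w).toList := by
        rw [← Multiset.coe_eq_coe, Multiset.coe_toList, Fin.univ_val_map]
      have h := this.map (fun j => iteratedDeriv j u t)
      rwa [List.map_ofFn] at h
    exact congrFun (DLf_perm hf hperm (by simpa using hk)) (u t)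
  have h1 := iteratedDeriv_vcomp_eq_sum_orderedFinpartition (i := n) (x := t)
    hf.contDiffAt hu.contDiffAt le_rfl
  change iteratedDeriv n (f ∘ u) t = _
  rw [h1, Finset.sum_congr rfl (fun c _ => hG c.length c.partSize c.length_le)]
  refine (sum_OFP n G).trans ?_
  rw [← finsum_mem_coe_finset]
  symm
  apply finsum_mem_eq_of_bijOn msOf (bij_msOf n)
  intro s hs
  have hle : ∑ j, s j ≤ n := by
    have hs' : ∑ j : Fin n, (j.val + 1) * s j = n := hs
    calc ∑ j, s j ≤ ∑ j : Fin n, (j.val + 1) * s j :=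
          Finset.sum_le_sum fun j _ => Nat.le_mul_of_pos_left _ (by omega)
      _ = n := hs'
  have h2 := hG _ (fun ν : Fin (∑ j, s j) => blockIndex s ν.1 + 1) hle
  rw [map_blockIndex] at h2
  rw [ContinuousMultilinearMap.map_smul_univ, h2, smul_smul, cf_msOf, div_eq_mul_inv, mul_assoc]
end

section
/- Accuracy of the approximate flux time derivatives: Let R ≥ 1 and 1 ≤ k ≤ R−1 be integers, q = ⌈(R−k)/2⌉, s = ⌊(k−1)/2⌋ + q, τ > 0, and let β_{−s},…,β_s be the unique reals with Σ_{l=−s}^{s} β_l l^r = 0 for r ∈ {0,…,2s}, r ≠ k, and Σ_{l=−s}^{s} β_l l^k = k!. Let f: ℝ^m → ℝ^m be of class C^∞ and u: ℝ → ℝ^m of class C^k on a neighborhood of a fixed t ∈ ℝ. Suppose that for each h > 0 we are given vectors ũ^{(0)}(h), …, ũ^{(k)}(h) ∈ ℝ^m with ũ^{(0)}(h) = u(t) and ũ^{(l)}(h) = u^{(l)}(t) + O(h^{R−l+1}) as h → 0⁺ for 1 ≤ l ≤ k, and define T_h(ρ) = Σ_{l=0}^{k} (ρ^l / l!) · ũ^{(l)}(h)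 and δ = τ h. Then (1/δ^k) Σ_{l=−s}^{s} β_l · f(T_h(l·δ)) = (d^k/ds^k)[f(u(s))]|_{s=t} + O(h^{R−k}) as h → 0⁺. -/
open Finset Asymptotics Topology

lemma aux_moment (S k : ℕ) (hk : Even k) (β : ℤ → ℝ)
    (hβ0 : ∀ r ≤ 2 * S, r ≠ k →
        ∑ l ∈ Finset.Icc (-(S : ℤ)) (S : ℤ), β l * (l : ℝ) ^ r = 0) (r : ℕ) (hr : Odd r) :
    ∑ l ∈ Finset.Icc (-(S : ℤ)) (S : ℤ), β l * (l : ℝ) ^ r = 0 := by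
  have hneg : ∀ F : ℤ → ℝ, ∑ l ∈ Finset.Icc (-(S : ℤ)) (S : ℤ), F (-l)
      = ∑ l ∈ Finset.Icc (-(S : ℤ)) (S : ℤ), F l := by
    intro F
    refine Finset.sum_bij' (fun l _ => -l) (fun l _ => -l) ?_ ?_ ?_ ?_ ?_
    · intro a ha; simp only [Finset.mem_Icc] at *; omega
    · intro a ha; simp only [Finset.mem_Icc] at *; omega
    · intro a ha; simp
    · intro a ha; simp
    · intro a ha; simp
  have hfin : ∀ F : ℤ → ℝ, ∑ i : Fin (2 * S + 1), F ((i : ℤ) - S)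
      = ∑ l ∈ Finset.Icc (-(S : ℤ)) (S : ℤ), F l := by
    intro F
    refine Finset.sum_bij (fun i _ => (i : ℤ) - S) ?_ ?_ ?_ ?_
    · intro a ha; simp only [Finset.mem_Icc]; omega
    · intro a ha b hb h; ext; simp at h; omega
    · intro b hb
      simp only [Finset.mem_Icc] at hb
      exact ⟨⟨(b + S).toNat, by omega⟩, Finset.mem_univ _, by simp; omega⟩
    · intro a ha; rfl
  have key : (fun i : Fin (2 * S + 1) => β ((i : ℤ) - S) - β (-((i : ℤ) - S))) = 0 := by
    apply Matrix.eq_zero_of_forall_pow_sum_mul_pow_eq_zero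
      (f := fun i : Fin (2 * S + 1) => (((i : ℤ) - S : ℤ) : ℝ))
    · intro a b h
      have h' : ((a : ℤ) - S : ℤ) = (b : ℤ) - S := by
        have h2 : (((a : ℤ) - S : ℤ) : ℝ) = (((b : ℤ) - S : ℤ) : ℝ) := h
        exact Int.cast_injective h2
      ext; omega
    · intro i
      rw [hfin (fun l => (β l - β (-l)) * (l : ℝ) ^ (i : ℕ))]
      have h1 : ∑ l ∈ Finset.Icc (-(S : ℤ)) (S : ℤ), β (-l) * (l : ℝ) ^ (i : ℕ)
          = (-1) ^ (i : ℕ) * ∑ l ∈ Finset.Icc (-(S : ℤ)) (S : ℤ), β l * (l : ℝ) ^ (i : ℕ) := by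
        rw [← hneg, Finset.mul_sum]
        refine Finset.sum_congr rfl fun l _ => ?_
        push_cast
        rw [neg_neg, neg_pow]; ring
      simp only [sub_mul, Finset.sum_sub_distrib]
      rw [h1]
      rcases Nat.even_or_odd (i : ℕ) with h | h
      · rw [h.neg_one_pow]; ring
      · rw [hβ0 i (by omega) (by rintro h2; rw [h2] at h; exact (Nat.not_odd_iff_even.2 hk) h)]
        ring
  have hsym : ∀ l ∈ Finset.Icc (-(S : ℤ)) (S : ℤ), β (-l) = β l := by
    intro l hl
    simp only [Finset.mem_Icc] at hl
    have := congrFun key ⟨(l + S).toNat, by omega⟩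
    have h2 : (((l + S).toNat : ℤ)) - S = l := by omega
    simp only [h2, Pi.zero_apply] at this
    linarith
  have h3 : ∑ l ∈ Finset.Icc (-(S : ℤ)) (S : ℤ), β l * (l : ℝ) ^ r
      = - ∑ l ∈ Finset.Icc (-(S : ℤ)) (S : ℤ), β l * (l : ℝ) ^ r := by
    conv_lhs => rw [← hneg]
    rw [← Finset.sum_neg_distrib]
    refine Finset.sum_congr rfl fun l hl => ?_
    rw [hsym l hl]; push_cast; rw [hr.neg_pow]; ring
  linarith

lemma aux_derivG {E : Type*} [NormedAddCommGroup E] [NormedSpace ℝ E] (A : Finset ℤ)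
    (β : ℤ → ℝ) (τ : ℝ) (g : ℝ → E) (hg : ContDiff ℝ (⊤ : ℕ∞) g) (r : ℕ) :
    iteratedDeriv r (fun h : ℝ => ∑ l ∈ A, β l • g ((l : ℝ) * (τ * h))) 0
      = (τ ^ r * ∑ l ∈ A, β l * (l : ℝ) ^ r) • iteratedDeriv r g 0 := by
  have hgr : ContDiff ℝ r g := hg.of_le (by exact_mod_cast le_top)
  rw [iteratedDeriv_fun_sum]
  · rw [Finset.mul_sum, Finset.sum_smul]
    refine Finset.sum_congr rfl fun l _ => ?_
    have h1 := iteratedDeriv_const_smul_field (𝕜 := ℝ) (x := (0:ℝ)) (n := r) (β l)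
      (fun h : ℝ => g ((l : ℝ) * (τ * h)))
    have h2 := congrFun (iteratedDeriv_comp_const_smul hgr ((l : ℝ) * τ)) 0
    simp only [mul_assoc] at h2
    change iteratedDeriv r (β l • fun h : ℝ => g ((l : ℝ) * (τ * h))) 0 = _
    rw [h1, h2, smul_smul]
    simp only [mul_zero, mul_pow]
    congr 1; ring
  · intro l _
    apply ContDiff.contDiffAt
    fun_prop

lemma aux_derivP {E : Type*} [NormedAddCommGroup E] [NormedSpace ℝ E] (k : ℕ) (v : ℕ → E)
    (i : ℕ) (hi : i ≤ k) :
    iteratedDeriv i (fun ρ : ℝ => ∑ j ∈ Finset.range (k + 1), (ρ ^ j / j.factorial) • v j) 0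
      = v i := by
  rw [iteratedDeriv_fun_sum (fun j _ => by apply ContDiff.contDiffAt; fun_prop)]
  rw [Finset.sum_eq_single i]
  · rw [iteratedDeriv_smul_const (by apply ContDiff.contDiffAt; fun_prop)]
    simp only [div_eq_inv_mul]
    rw [iteratedDeriv_const_mul _ (by apply ContDiff.contDiffAt; fun_prop),
      iteratedDeriv_fun_pow_zero]
    have : (i.factorial : ℝ) ≠ 0 := by positivity
    simp [this]
  · intro j _ hj
    rw [iteratedDeriv_smul_const (by apply ContDiff.contDiffAt; fun_prop)]
    simp only [div_eq_inv_mul]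
    rw [iteratedDeriv_const_mul _ (by apply ContDiff.contDiffAt; fun_prop),
      iteratedDeriv_fun_pow_zero]
    simp [hj.symm]
  · intro h; simp at h; omega

lemma aux_comp {E : Type*} [NormedAddCommGroup E] [NormedSpace ℝ E] (k : ℕ)
    (f : E → E) (hf : ContDiff ℝ k f) (u P : ℝ → E) (t : ℝ)
    (hu : ContDiffAt ℝ k u t) (hP : ContDiffAt ℝ k P 0)
    (h : ∀ i ≤ k, iteratedDeriv i P 0 = iteratedDeriv i u t) :
    iteratedDeriv k (fun s => f (P s)) 0 = iteratedDeriv k (fun s => f (u s)) t := by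
  have h0 : P 0 = u t := by simpa using h 0 (Nat.zero_le _)
  have e1 := iteratedDeriv_vcomp_eq_sum_orderedFinpartition (i := k) (g := f)
    hf.contDiffAt hP le_rfl
  have e2 := iteratedDeriv_vcomp_eq_sum_orderedFinpartition (i := k) (g := f)
    hf.contDiffAt hu le_rfl
  change iteratedDeriv k (f ∘ P) 0 = iteratedDeriv k (f ∘ u) t
  rw [e1, e2, h0]
  refine Finset.sum_congr rfl fun c _ => ?_
  congr 1
  funext j
  exact h _ (c.partSize_le j)

lemma aux_taylor {E : Type*} [NormedAddCommGroup E] [NormedSpace ℝ E] (G : ℝ → E)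
    (hG : ContDiff ℝ (⊤ : ℕ∞) G) (n k : ℕ) (hk : k ≤ n)
    (hz : ∀ r ≤ n, r ≠ k → iteratedDeriv r G 0 = 0) :
    (fun h : ℝ => G h - (h ^ k / k.factorial) • iteratedDeriv k G 0)
      =O[𝓝[>] (0 : ℝ)] fun h : ℝ => h ^ (n + 1) := by
  have hGn : ∀ n : ℕ, ContDiff ℝ n G := fun n => hG.of_le (by exact_mod_cast le_top)
  obtain ⟨C, hC⟩ := exists_taylor_mean_remainder_bound (f := G) (n := n) (zero_le_one' ℝ)
    (by exact_mod_cast (hGn (n + 1)).contDiffOn)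
  refine IsBigO.of_bound C ?_
  filter_upwards [Ioo_mem_nhdsGT (zero_lt_one' ℝ)] with h hh
  have := hC h ⟨hh.1.le, hh.2.le⟩
  rw [taylor_within_apply, Finset.sum_eq_single k] at this
  · rw [iteratedDerivWithin_eq_iteratedDeriv (uniqueDiffOn_Icc zero_lt_one)
      (hGn k).contDiffAt (by simp), sub_zero] at this
    rw [Real.norm_of_nonneg (pow_nonneg hh.1.le _), div_eq_inv_mul]
    exact this
  · intro r hr hrk
    rw [iteratedDerivWithin_eq_iteratedDeriv (uniqueDiffOn_Icc zero_lt_one)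
      (hGn r).contDiffAt (by simp), hz r (by simp at hr; omega) hrk, smul_zero]
  · intro h; simp at h; omega

/-- **Accuracy of the approximate flux time derivatives.**  Let `1 ≤ k ≤ R-1`,
`q = ⌈(R-k)/2⌉`, `s = ⌊(k-1)/2⌋ + q` and let `β_{-s},…,β_s` be the centered finite
difference coefficients for the `k`-th derivative of order `2q` (`Σ β_l l^r = 0` for
`r ∈ {0,…,2s}`, `r ≠ k`, and `Σ β_l l^k = k!`).  Let `f` be `C^∞`, `u` be `C^k` near `t`,
and suppose `ũ^{(0)}(h) = u(t)` and `ũ^{(l)}(h) = u^{(l)}(t) + O(h^{R-l+1})` for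
`1 ≤ l ≤ k`.  With `T_h(ρ) = ∑_{l=0}^k (ρ^l/l!) ũ^{(l)}(h)` and `δ = τ h`,
`δ^{-k} ∑_{l=-s}^{s} β_l f(T_h(lδ)) = (d^k/ds^k)[f(u(s))]|_{s=t} + O(h^{R-k})`
as `h → 0⁺`. -/
theorem approx_flux_time_derivative_accuracy (R k m : ℕ)
    (hk1 : 1 ≤ k) (hkR : k ≤ R - 1) (hR : 1 ≤ R) (hm : 1 ≤ m)
    (Q S : ℕ) (hQ : Q = (R - k + 1) / 2) (hS : S = (k - 1) / 2 + Q)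
    (τ : ℝ) (hτ : 0 < τ) (β : ℤ → ℝ)
    (hβ0 : ∀ r ≤ 2 * S, r ≠ k →
        ∑ l ∈ Finset.Icc (-(S : ℤ)) (S : ℤ), β l * (l : ℝ) ^ r = 0)
    (hβk : ∑ l ∈ Finset.Icc (-(S : ℤ)) (S : ℤ), β l * (l : ℝ) ^ k = k.factorial)
    (f : (Fin m → ℝ) → Fin m → ℝ) (hf : ContDiff ℝ (⊤ : ℕ∞) f)
    (t : ℝ) (u : ℝ → Fin m → ℝ) (hu : ContDiffAt ℝ k u t)
    (utld : ℝ → ℕ → Fin m → ℝ)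
    (h0 : ∀ h : ℝ, utld h 0 = u t)
    (hl : ∀ l : ℕ, 1 ≤ l → l ≤ k →
      (fun h : ℝ => utld h l - iteratedDeriv l u t)
        =O[𝓝[>] (0 : ℝ)] fun h : ℝ => h ^ (R - l + 1)) :
    (fun h : ℝ =>
        ((τ * h) ^ k)⁻¹ •
            (∑ l ∈ Finset.Icc (-(S : ℤ)) (S : ℤ), β l •
              f (∑ j ∈ Finset.range (k + 1),
                  (((l : ℝ) * (τ * h)) ^ j / j.factorial) • utld h j)) -
          iteratedDeriv k (fun s' : ℝ => f (u s')) t)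
      =O[𝓝[>] (0 : ℝ)] fun h : ℝ => h ^ (R - k) := by
  obtain ⟨v, hv⟩ : ∃ v : ℕ → Fin m → ℝ, v = fun j => iteratedDeriv j u t := ⟨_, rfl⟩
  obtain ⟨P, hPdef⟩ : ∃ P : ℝ → Fin m → ℝ, P = fun ρ : ℝ =>
    ∑ j ∈ Finset.range (k + 1), (ρ ^ j / j.factorial) • v j := ⟨_, rfl⟩
  have hP : ContDiff ℝ (⊤ : ℕ∞) P := by rw [hPdef]; fun_prop
  have hPd : ∀ i ≤ k, iteratedDeriv i P 0 = iteratedDeriv i u t := by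
    intro i hi
    rw [hPdef, aux_derivP k v i hi, hv]
  have hP0 : P 0 = u t := by simpa using hPd 0 (Nat.zero_le _)
  have hg : ContDiff ℝ (⊤ : ℕ∞) (fun ρ => f (P ρ)) := hf.comp hP
  have hgk : iteratedDeriv k (fun ρ => f (P ρ)) 0 = iteratedDeriv k (fun s => f (u s)) t :=
    aux_comp k f (hf.of_le (by exact_mod_cast le_top)) u P t hu
      (hP.of_le (by exact_mod_cast le_top)).contDiffAt hPd
  -- moments
  have hmom : ∀ r ≤ R - 1, r ≠ k →
      ∑ l ∈ Finset.Icc (-(S : ℤ)) (S : ℤ), β l * (l : ℝ) ^ r = 0 := by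
    intro r hr hrk
    by_cases h : r ≤ 2 * S
    · exact hβ0 r h hrk
    · have hke : Even k := by rw [Nat.even_iff]; omega
      have hro : Odd r := by rw [Nat.odd_iff]; omega
      exact aux_moment S k hke β hβ0 r hro
  set A := Finset.Icc (-(S : ℤ)) (S : ℤ) with hA
  have hG : ContDiff ℝ (⊤ : ℕ∞)
      (fun h : ℝ => ∑ l ∈ A, β l • f (P ((l : ℝ) * (τ * h)))) := by
    fun_prop
  have hGd := aux_derivG A β τ (fun ρ => f (P ρ)) hg
  have hT := aux_taylor _ hG (R - 1) k hkR (by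
    intro r hr hrk
    rw [hGd, hmom r hr hrk]; simp)
  rw [hGd k, hβk, hgk, show R - 1 + 1 = R by omega] at hT
  -- perturbation
  have hpow : ∀ (l : ℤ), (fun h : ℝ => (∑ j ∈ Finset.range (k + 1),
        (((l : ℝ) * (τ * h)) ^ j / j.factorial) • utld h j) - P ((l : ℝ) * (τ * h)))
      =O[𝓝[>] (0 : ℝ)] fun h : ℝ => h ^ (R + 1) := by
    intro l
    simp only [hPdef, ← Finset.sum_sub_distrib, ← smul_sub]
    refine IsBigO.fun_sum fun j hj => ?_
    rcases Nat.eq_zero_or_pos j with rfl | hj0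
    · simp only [h0, hv, iteratedDeriv_zero, sub_self, smul_zero]
      exact isBigO_zero _ _
    · have hjk : j ≤ k := by simp at hj; omega
      have h1 : (fun h : ℝ => ((l : ℝ) * (τ * h)) ^ j / j.factorial)
          =O[𝓝[>] (0 : ℝ)] fun h : ℝ => h ^ j := by
        have : (fun h : ℝ => ((l : ℝ) * (τ * h)) ^ j / j.factorial)
          = fun h : ℝ => (((l : ℝ) * τ) ^ j / j.factorial) * h ^ j := by
          funext h; rw [← mul_assoc, mul_pow]; ring
        rw [this]
        exact isBigO_const_mul_self _ _ _
      have h2 := h1.smul (hl j hj0 hjk)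
      rw [hv]
      refine h2.congr_right fun h => ?_
      rw [smul_eq_mul, ← pow_add]; congr 1; omega
  have hfd : ∀ (l : ℤ), (fun h : ℝ => f (∑ j ∈ Finset.range (k + 1),
        (((l : ℝ) * (τ * h)) ^ j / j.factorial) • utld h j) - f (P ((l : ℝ) * (τ * h))))
      =O[𝓝[>] (0 : ℝ)] fun h : ℝ => h ^ (R + 1) := by
    intro l
    have hPt : Filter.Tendsto (fun h : ℝ => P ((l : ℝ) * (τ * h))) (𝓝[>] (0 : ℝ)) (𝓝 (u t)) := by
      have hc : Continuous (fun h : ℝ => P ((l : ℝ) * (τ * h))) :=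
        hP.continuous.comp (by fun_prop)
      have := hc.tendsto 0
      simp only [mul_zero, hP0] at this
      exact this.mono_left nhdsWithin_le_nhds
    have hz : Filter.Tendsto (fun h : ℝ => h ^ (R + 1)) (𝓝[>] (0 : ℝ)) (𝓝 0) := by
      have hc : Continuous (fun h : ℝ => h ^ (R + 1)) := by fun_prop
      have := hc.tendsto 0
      simp only [zero_pow (Nat.succ_ne_zero R)] at this
      exact this.mono_left nhdsWithin_le_nhds
    have hTt := ((hpow l).trans_tendsto hz).add hPt
    simp only [sub_add_cancel, zero_add] at hTt
    have hs : HasStrictFDerivAt f (fderiv ℝ f (u t)) (u t) :=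
      hf.contDiffAt.hasStrictFDerivAt (by simp)
    exact (hs.isBigO_sub.comp_tendsto (hTt.prodMk_nhds hPt)).trans (hpow l)
  have hsum : (fun h : ℝ => ∑ l ∈ A, β l • (f (∑ j ∈ Finset.range (k + 1),
        (((l : ℝ) * (τ * h)) ^ j / j.factorial) • utld h j) - f (P ((l : ℝ) * (τ * h)))))
      =O[𝓝[>] (0 : ℝ)] fun h : ℝ => h ^ R := by
    refine IsBigO.fun_sum fun l _ => IsBigO.trans ((hfd l).const_smul_left (β l)) ?_
    refine IsBigO.of_bound 1 ?_
    filter_upwards [Ioo_mem_nhdsGT (zero_lt_one' ℝ)] with h hh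
    rw [Real.norm_of_nonneg (pow_nonneg hh.1.le _), Real.norm_of_nonneg (pow_nonneg hh.1.le _),
      one_mul]
    exact pow_le_pow_of_le_one hh.1.le hh.2.le (Nat.le_succ R)
  have hinv : (fun h : ℝ => ((τ * h) ^ k)⁻¹) =O[𝓝[>] (0 : ℝ)] fun h : ℝ => (h ^ k)⁻¹ := by
    simp only [mul_pow, mul_inv]
    exact isBigO_const_mul_self _ _ _
  have hfinal := hinv.smul (hsum.add hT)
  refine hfinal.congr' ?_ ?_
  · filter_upwards [self_mem_nhdsWithin] with h hh
    have hh' : (0 : ℝ) < h := hh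
    have hne : (τ * h) ^ k ≠ 0 := by positivity
    have hfk : (k.factorial : ℝ) ≠ 0 := by positivity
    simp only [smul_sub, Finset.sum_sub_distrib]
    rw [sub_add_sub_cancel, smul_sub, smul_smul, smul_smul]
    congr 1
    rw [show ((τ * h) ^ k)⁻¹ * (h ^ k / k.factorial) * (τ ^ k * k.factorial) = 1 by
      rw [mul_pow] at hne ⊢; field_simp, one_smul]
  · filter_upwards [self_mem_nhdsWithin] with h hh
    have hh' : (0 : ℝ) < h := hh
    rw [smul_eq_mul, mul_comm, ← div_eq_mul_inv, pow_sub₀ _ hh'.ne' (by omega), div_eq_mul_inv]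
end
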